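/- Fix an integer n ≥ 1 and let d = 2^n. Let V, W be nontrivial Pauli strings, let ρ ∈ M_d(ℂ) be arbitrary, let E₁, E₂ ∈ M_d(ℂ) satisfy Tr E₁ = Tr E₂ = 1, and let a₁, a₂, b₁, b₂ ∈ M_d(ℂ) be unitary. For a unitary g, let τ(g) be the (d²−1)×(d²−1) matrix indexed by 𝒫⁰ with entries [τ(g)]_{σ,σ'} = Tr(σ·g σ' g†); let A be the matrix indexed by 𝒫⁰×𝒫⁰ with entries A_{(σ₁,σ₂),(σ₁',σ₂')} = (d²−1)²·Tr(Wσ₁Wσ₁)·δ_{σ₁,σ₂}·Tr(Vσ₁')·Tr(Vσ₂'), and let B have entries B_{(σ₁,σ₂),(σ₁',σ₂')} = Tr(σ₁ρ)·Tr(E₁σ₁')·Tr(σ₂ρ)·Tr(E₂σ₂'). Then Tr( B·(τ(a₂)⊗τ(b₂))·A·(τ(a₁)⊗τ(b₁)) ) = (d²−1)²·( Tr(W·a₂† E₁ a₂·W·b₂† E₂ b₂) − 1/d )·Tr(V·a₁ ρ a₁†)·Tr(V·b₁ ρ b₁†). -/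

import Mathlib

open Matrix Kronecker BigOperators

noncomputable section

/-- The 2×2 Pauli matrices `I₂, X, Y, Z`, indexed by `Fin 4`. -/
def pauli : Fin 4 → Matrix (Fin 2) (Fin 2) ℂ
  | 0 => 1
  | 1 => !![0, 1; 1, 0]
  | 2 => !![0, -Complex.I; Complex.I, 0]
  | 3 => !![1, 0; 0, -1]

/-- The Pauli string `pauli (s 0) ⊗ ⋯ ⊗ pauli (s (n-1))`, realized as a matrix on
`ℂ^{2^n}` with the index set `Fin n → Fin 2` (so `d = 2^n`).  The string is trivial
(equal to `I_d`) exactly when `s = fun _ => 0`. -/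
def pauliString {n : ℕ} (s : Fin n → Fin 4) :
    Matrix (Fin n → Fin 2) (Fin n → Fin 2) ℂ :=
  Matrix.of fun i j => ∏ k : Fin n, pauli (s k) (i k) (j k)

/-- The normalized Pauli operator `σ_s / √d` with `d = 2^n`; these form the
orthonormal basis `𝒫` of `M_d(ℂ)` for the Hilbert–Schmidt inner product. -/
def normPauli {n : ℕ} (s : Fin n → Fin 4) :
    Matrix (Fin n → Fin 2) (Fin n → Fin 2) ℂ :=
  ((Real.sqrt (2 ^ n) : ℂ))⁻¹ • pauliString s

/-- The swap operator `F` on `ℂ^d ⊗ ℂ^d`, determined by `F (u ⊗ v) = v ⊗ u`. -/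
def swapOp (I : Type*) [DecidableEq I] : Matrix (I × I) (I × I) ℂ :=
  Matrix.of fun p q => if p.1 = q.2 ∧ p.2 = q.1 then 1 else 0

/-- The index set labelling the normalized nontrivial Pauli operators `𝒫⁰`. -/
abbrev P0 (n : ℕ) := {s : Fin n → Fin 4 // s ≠ fun _ => 0}

/-- The adjoint-representation matrix `τ(g)`, indexed by `𝒫⁰`, with entries
`[τ(g)]_{σ,σ'} = Tr(σ · g σ' g†)`. -/
def tauAd {n : ℕ} (g : Matrix (Fin n → Fin 2) (Fin n → Fin 2) ℂ) :
    Matrix (P0 n) (P0 n) ℂ :=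
  Matrix.of fun σ σ' => Matrix.trace (normPauli σ.1 * (g * normPauli σ'.1 * gᴴ))

/-- General tensor product of single-site matrices. -/
def tens15 {n : ℕ} (M : Fin n → Matrix (Fin 2) (Fin 2) ℂ) :
    Matrix (Fin n → Fin 2) (Fin n → Fin 2) ℂ :=
  Matrix.of fun i j => ∏ k : Fin n, M k (i k) (j k)

lemma tens15_mul {n : ℕ} (M N : Fin n → Matrix (Fin 2) (Fin 2) ℂ) :
    tens15 M * tens15 N = tens15 fun k => M k * N k := by
  ext i j
  simp only [tens15, Matrix.mul_apply, Matrix.of_apply]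
  rw [Finset.prod_univ_sum, Fintype.piFinset_univ]
  simp only [Finset.prod_mul_distrib]

lemma tens15_trace {n : ℕ} (M : Fin n → Matrix (Fin 2) (Fin 2) ℂ) :
    Matrix.trace (tens15 M) = ∏ k, Matrix.trace (M k) := by
  simp only [tens15, Matrix.trace, Matrix.diag_apply, Matrix.of_apply]
  rw [Finset.prod_univ_sum, Fintype.piFinset_univ]

lemma tens15_smul {n : ℕ} (c : Fin n → ℂ) (M : Fin n → Matrix (Fin 2) (Fin 2) ℂ) :
    tens15 (fun k => c k • M k) = (∏ k, c k) • tens15 M := by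
  ext i j
  simp [tens15, Finset.prod_mul_distrib]

lemma tens15_one {n : ℕ} : tens15 (n := n) (fun _ => 1) = 1 := by
  ext i j
  simp only [tens15, Matrix.of_apply, Matrix.one_apply]
  rw [Finset.prod_ite_zero]
  simp [funext_iff]

lemma pauliString_eq {n : ℕ} (s : Fin n → Fin 4) :
    pauliString s = tens15 fun k => pauli (s k) := rfl

lemma pauliString_zero15 {n : ℕ} : pauliString (n := n) (fun _ => 0) = 1 := by
  rw [pauliString_eq]; exact tens15_one

lemma pauli_trace15 (p : Fin 4) (hp : p ≠ 0) : Matrix.trace (pauli p) = 0 := by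
  fin_cases p <;> simp_all [pauli, Matrix.trace, Fin.sum_univ_two]

lemma pauliString_trace15 {n : ℕ} (s : Fin n → Fin 4) (hs : s ≠ fun _ => 0) :
    Matrix.trace (pauliString s) = 0 := by
  rw [pauliString_eq, tens15_trace]
  obtain ⟨k, hk⟩ := Function.ne_iff.mp hs
  exact Finset.prod_eq_zero (Finset.mem_univ k) (pauli_trace15 _ hk)

lemma pauli_sq15 (p : Fin 4) : pauli p * pauli p = 1 := by
  fin_cases p <;> ext i j <;> fin_cases i <;> fin_cases j <;>
    simp [pauli, Matrix.mul_apply, Fin.sum_univ_two]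

lemma pauli_conj15 (p q : Fin 4) : ∃ c : ℂ, pauli p * pauli q * pauli p = c • pauli q := by
  by_cases h : p = q ∨ p = 0 ∨ q = 0
  · refine ⟨1, ?_⟩
    rcases h with h | h | h
    · subst h; rw [pauli_sq15]; simp
    · subst h; simp [pauli]
    · subst h; simpa [pauli] using pauli_sq15 p
  · refine ⟨-1, ?_⟩
    fin_cases p <;> fin_cases q <;> first
      | (exfalso; revert h; decide)
      | (ext i j; fin_cases i <;> fin_cases j <;>
          simp [pauli, Matrix.mul_apply, Fin.sum_univ_two])

lemma pauliString_sq15 {n : ℕ} (s : Fin n → Fin 4) : pauliString s * pauliString s = 1 := by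
  rw [pauliString_eq, tens15_mul]
  simp only [pauli_sq15, tens15_one]

lemma pauliString_conj15 {n : ℕ} (s t : Fin n → Fin 4) :
    ∃ c : ℂ, pauliString s * pauliString t * pauliString s = c • pauliString t := by
  choose c hc using pauli_conj15
  refine ⟨∏ k, c (s k) (t k), ?_⟩
  simp only [pauliString_eq, tens15_mul, hc, tens15_smul]

lemma sqrt15 (n : ℕ) : ((Real.sqrt (2 ^ n) : ℂ))⁻¹ * ((Real.sqrt (2 ^ n) : ℂ))⁻¹
    = ((2 ^ n : ℂ))⁻¹ := by
  rw [← mul_inv, ← Complex.ofReal_mul, Real.mul_self_sqrt (by positivity)]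
  push_cast; rfl

lemma normPauli_sq15 {n : ℕ} (s : Fin n → Fin 4) :
    normPauli s * normPauli s = ((2 ^ n : ℂ))⁻¹ • (1 : Matrix _ _ ℂ) := by
  simp only [normPauli, Matrix.smul_mul, Matrix.mul_smul, smul_smul, pauliString_sq15, sqrt15]

lemma normPauli_trace15 {n : ℕ} (s : P0 n) : Matrix.trace (normPauli s.1) = 0 := by
  simp [normPauli, pauliString_trace15 _ s.2]

/-- `Tr(WσWσ) σ = WσW`. -/
lemma normPauli_conj15 {n : ℕ} (s t : Fin n → Fin 4) :
    Matrix.trace (pauliString s * normPauli t * pauliString s * normPauli t) • normPauli t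
      = pauliString s * normPauli t * pauliString s := by
  obtain ⟨c, hc⟩ := pauliString_conj15 s t
  have h : pauliString s * normPauli t * pauliString s = c • normPauli t := by
    simp only [normPauli, Matrix.smul_mul, Matrix.mul_smul, hc]
    rw [smul_comm]
  rw [h, Matrix.smul_mul, normPauli_sq15, Matrix.trace_smul, Matrix.trace_smul, Matrix.trace_one]
  congr 1
  simp

lemma pauli_complete15 (i j k l : Fin 2) :
    ∑ p, pauli p i j * pauli p k l = if i = l ∧ j = k then 2 else 0 := by
  fin_cases i <;> fin_cases j <;> fin_cases k <;> fin_cases l <;>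
    simp [pauli, Fin.sum_univ_four] <;> norm_num

lemma pauliString_complete15 {n : ℕ} (i j k l : Fin n → Fin 2) :
    ∑ s, pauliString s i j * pauliString s k l = if i = l ∧ j = k then 2 ^ n else 0 := by
  simp only [pauliString, Matrix.of_apply, ← Finset.prod_mul_distrib]
  have := Finset.prod_univ_sum (fun _ : Fin n => (Finset.univ : Finset (Fin 4)))
    (fun a p => pauli p (i a) (j a) * pauli p (k a) (l a))
  rw [Fintype.piFinset_univ] at this
  rw [← this]
  simp only [pauli_complete15]
  rw [Finset.prod_ite_zero]
  simp [funext_iff, forall_and]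

lemma normPauli_complete15 {n : ℕ} (i j k l : Fin n → Fin 2) :
    ∑ s, normPauli s i j * normPauli s k l = if i = l ∧ j = k then 1 else 0 := by
  have : ∀ s : Fin n → Fin 4, normPauli s i j * normPauli s k l
      = ((2 ^ n : ℂ))⁻¹ * (pauliString s i j * pauliString s k l) := by
    intro s
    rw [← sqrt15]
    simp only [normPauli, Matrix.smul_apply, smul_eq_mul]
    ring
  simp only [this, ← Finset.mul_sum, pauliString_complete15]
  split_ifs <;> simp

lemma trace_complete15 {n : ℕ} (M N : Matrix (Fin n → Fin 2) (Fin n → Fin 2) ℂ) :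
    ∑ s, Matrix.trace (M * normPauli s) * Matrix.trace (N * normPauli s)
      = Matrix.trace (M * N) := by
  have : ∀ s : Fin n → Fin 4, Matrix.trace (M * normPauli s) * Matrix.trace (N * normPauli s)
      = ∑ i, ∑ j, ∑ k, ∑ l, M i j * N k l * (normPauli s j i * normPauli s l k) := by
    intro s
    simp only [Matrix.trace, Matrix.diag_apply, Matrix.mul_apply, Finset.sum_mul]
    simp only [Finset.mul_sum]
    refine Finset.sum_congr rfl fun i _ => Finset.sum_congr rfl fun j _ =>
      Finset.sum_congr rfl fun k _ => Finset.sum_congr rfl fun l _ => by ring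
  simp only [this]
  rw [Finset.sum_comm]
  simp only [Matrix.trace, Matrix.diag_apply, Matrix.mul_apply]
  refine Finset.sum_congr rfl fun i _ => ?_
  rw [Finset.sum_comm]
  refine Finset.sum_congr rfl fun j _ => ?_
  rw [Finset.sum_comm, Finset.sum_eq_single j]
  · rw [Finset.sum_comm, Finset.sum_eq_single i]
    · rw [← Finset.mul_sum, normPauli_complete15]; simp
    · intro l _ hl
      rw [← Finset.mul_sum, normPauli_complete15, if_neg (by tauto), mul_zero]
    · simp
  · intro k _ hk
    rw [Finset.sum_comm]
    refine Finset.sum_eq_zero fun l _ => ?_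
    rw [← Finset.mul_sum, normPauli_complete15, if_neg (by tauto), mul_zero]
  · simp

lemma trace_complete15' {n : ℕ} (M N : Matrix (Fin n → Fin 2) (Fin n → Fin 2) ℂ) :
    ∑ s : P0 n, Matrix.trace (M * normPauli s.1) * Matrix.trace (N * normPauli s.1)
      = Matrix.trace (M * N) - ((2 ^ n : ℂ))⁻¹ * (Matrix.trace M * Matrix.trace N) := by
  rw [← trace_complete15]
  rw [Fintype.sum_eq_add_sum_subtype_ne _ (fun _ => (0 : Fin 4))]
  have : normPauli (n := n) (fun _ => 0) = ((Real.sqrt (2 ^ n) : ℂ))⁻¹ • 1 := by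
    rw [normPauli, pauliString_zero15]
  rw [this, ← sqrt15]
  simp only [Matrix.mul_smul, Matrix.mul_one, Matrix.trace_smul, smul_eq_mul]
  ring

lemma trace_rank_one15 {ι : Type*} [Fintype ι] (u v w x : ι → ℂ) (S T : Matrix ι ι ℂ) :
    Matrix.trace (Matrix.vecMulVec u v * S * Matrix.vecMulVec w x * T)
      = ((v ᵥ* S) ⬝ᵥ w) * ((x ᵥ* T) ⬝ᵥ u) := by
  rw [Matrix.vecMulVec_mul, Matrix.vecMulVec_mul_vecMulVec, Matrix.vecMulVec_mul,
    Matrix.trace_vecMulVec]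
  simp [Matrix.smul_vecMul, dotProduct_comm]

lemma kron_vecMul15 {ι : Type*} [Fintype ι] (v v' : ι → ℂ) (S T : Matrix ι ι ℂ) :
    (fun p : ι × ι => v p.1 * v' p.2) ᵥ* (S ⊗ₖ T) =
      fun p => (v ᵥ* S) p.1 * (v' ᵥ* T) p.2 := by
  ext p
  simp only [Matrix.vecMul, dotProduct, Fintype.sum_prod_type, Matrix.kroneckerMap_apply,
    Finset.sum_mul]
  simp only [Finset.mul_sum]
  refine Finset.sum_congr rfl fun i _ => Finset.sum_congr rfl fun j _ => by ring

lemma tau_vecMul15 {n : ℕ} (E g : Matrix (Fin n → Fin 2) (Fin n → Fin 2) ℂ) (hg : gᴴ * g = 1) :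
    (fun σ : P0 n => Matrix.trace (E * normPauli σ.1)) ᵥ* tauAd g =
      fun σ => Matrix.trace (gᴴ * E * g * normPauli σ.1) := by
  ext σ
  have h := trace_complete15' E (g * normPauli σ.1 * gᴴ)
  have h0 : Matrix.trace (g * normPauli σ.1 * gᴴ) = 0 := by
    rw [Matrix.trace_mul_cycle, hg, Matrix.one_mul, normPauli_trace15]
  rw [h0] at h
  simp only [Matrix.vecMul, dotProduct, tauAd, Matrix.of_apply]
  simp only [mul_zero, sub_zero] at h
  have e : Matrix.trace (gᴴ * E * g * normPauli σ.1)
      = Matrix.trace (E * (g * normPauli σ.1 * gᴴ)) := by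
    rw [Matrix.mul_assoc, Matrix.mul_assoc, Matrix.trace_mul_comm]
    simp only [Matrix.mul_assoc]
  rw [e, ← h]
  refine Finset.sum_congr rfl fun s _ => ?_
  rw [Matrix.trace_mul_comm (normPauli s.1)]

lemma chain15 {n : ℕ} (V ρ g : Matrix (Fin n → Fin 2) (Fin n → Fin 2) ℂ)
    (hV : Matrix.trace V = 0) (hg : gᴴ * g = 1) (hg' : g * gᴴ = 1) :
    ((fun σ : P0 n => Matrix.trace (V * normPauli σ.1)) ᵥ* tauAd g) ⬝ᵥ
      (fun σ : P0 n => Matrix.trace (normPauli σ.1 * ρ)) = Matrix.trace (V * (g * ρ * gᴴ)) := by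
  rw [tau_vecMul15 _ _ hg]
  simp only [dotProduct, Matrix.trace_mul_comm _ ρ]
  rw [trace_complete15']
  have h0 : Matrix.trace (gᴴ * V * g) = 0 := by
    rw [Matrix.trace_mul_cycle, hg', Matrix.one_mul, hV]
  rw [h0, zero_mul, mul_zero, sub_zero, Matrix.mul_assoc, Matrix.mul_assoc, Matrix.trace_mul_comm]
  simp only [Matrix.mul_assoc]

/-- Sequence-length-two closed form of the OTOC correlation function (Appendix E):
`Tr(B·(τ(a₂)⊗τ(b₂))·A·(τ(a₁)⊗τ(b₁))) =
 (d²−1)²·(Tr(W·a₂†E₁a₂·W·b₂†E₂b₂) − 1/d)·Tr(V·a₁ρa₁†)·Tr(V·b₁ρb₁†)`. -/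
theorem statement15 (n : ℕ) (hn : 1 ≤ n)
    (sV sW : Fin n → Fin 4) (hV : sV ≠ fun _ => 0) (hW : sW ≠ fun _ => 0)
    (ρ E₁ E₂ : Matrix (Fin n → Fin 2) (Fin n → Fin 2) ℂ)
    (hE₁ : Matrix.trace E₁ = 1) (hE₂ : Matrix.trace E₂ = 1)
    (a₁ a₂ b₁ b₂ : Matrix (Fin n → Fin 2) (Fin n → Fin 2) ℂ)
    (ha₁ : a₁ * a₁ᴴ = 1) (ha₁' : a₁ᴴ * a₁ = 1)
    (ha₂ : a₂ * a₂ᴴ = 1) (ha₂' : a₂ᴴ * a₂ = 1)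
    (hb₁ : b₁ * b₁ᴴ = 1) (hb₁' : b₁ᴴ * b₁ = 1)
    (hb₂ : b₂ * b₂ᴴ = 1) (hb₂' : b₂ᴴ * b₂ = 1)
    (A : Matrix (P0 n × P0 n) (P0 n × P0 n) ℂ)
    (hA : ∀ σ₁ σ₂ σ₁' σ₂' : P0 n, A (σ₁, σ₂) (σ₁', σ₂') =
      ((2 ^ n : ℂ) ^ 2 - 1) ^ 2 *
        Matrix.trace (pauliString sW * normPauli σ₁.1 * pauliString sW * normPauli σ₁.1) *
        (if σ₁ = σ₂ then 1 else 0) *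
        Matrix.trace (pauliString sV * normPauli σ₁'.1) *
        Matrix.trace (pauliString sV * normPauli σ₂'.1))
    (B : Matrix (P0 n × P0 n) (P0 n × P0 n) ℂ)
    (hB : ∀ σ₁ σ₂ σ₁' σ₂' : P0 n, B (σ₁, σ₂) (σ₁', σ₂') =
      Matrix.trace (normPauli σ₁.1 * ρ) * Matrix.trace (E₁ * normPauli σ₁'.1) *
        Matrix.trace (normPauli σ₂.1 * ρ) * Matrix.trace (E₂ * normPauli σ₂'.1)) :
    Matrix.trace (B * (tauAd a₂ ⊗ₖ tauAd b₂) * A * (tauAd a₁ ⊗ₖ tauAd b₁)) =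
      ((2 ^ n : ℂ) ^ 2 - 1) ^ 2 *
        (Matrix.trace (pauliString sW * (a₂ᴴ * E₁ * a₂) * pauliString sW * (b₂ᴴ * E₂ * b₂)) -
          ((2 ^ n : ℂ))⁻¹) *
        Matrix.trace (pauliString sV * (a₁ * ρ * a₁ᴴ)) *
        Matrix.trace (pauliString sV * (b₁ * ρ * b₁ᴴ)) := by
  have hBv : B = Matrix.vecMulVec
      (fun p => Matrix.trace (normPauli p.1.1 * ρ) * Matrix.trace (normPauli p.2.1 * ρ))
      (fun p => Matrix.trace (E₁ * normPauli p.1.1) * Matrix.trace (E₂ * normPauli p.2.1)) := by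
    ext ⟨p, p'⟩ ⟨q, q'⟩
    rw [hB, Matrix.vecMulVec_apply]; ring
  have hAv : A = Matrix.vecMulVec
      (fun p => ((2 ^ n : ℂ) ^ 2 - 1) ^ 2 *
        Matrix.trace (pauliString sW * normPauli p.1.1 * pauliString sW * normPauli p.1.1) *
        (if p.1 = p.2 then 1 else 0))
      (fun p => Matrix.trace (pauliString sV * normPauli p.1.1) *
        Matrix.trace (pauliString sV * normPauli p.2.1)) := by
    ext ⟨p, p'⟩ ⟨q, q'⟩
    rw [hA, Matrix.vecMulVec_apply]; ring
  have hVt := pauliString_trace15 sV hV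
  rw [hBv, hAv, trace_rank_one15]
  rw [kron_vecMul15 (fun σ : P0 n => Matrix.trace (E₁ * normPauli σ.1))
      (fun σ : P0 n => Matrix.trace (E₂ * normPauli σ.1)),
    kron_vecMul15 (fun σ : P0 n => Matrix.trace (pauliString sV * normPauli σ.1))
      (fun σ : P0 n => Matrix.trace (pauliString sV * normPauli σ.1))]
  rw [← chain15 _ ρ a₁ hVt ha₁' ha₁, ← chain15 _ ρ b₁ hVt hb₁' hb₁,
    tau_vecMul15 E₁ a₂ ha₂', tau_vecMul15 E₂ b₂ hb₂', mul_assoc (_ * _)]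
  congr 1
  · set F₁ := a₂ᴴ * E₁ * a₂ with hF₁
    set F₂ := b₂ᴴ * E₂ * b₂ with hF₂
    have t₁ : Matrix.trace F₁ = 1 := by
      rw [hF₁, Matrix.trace_mul_cycle, ha₂, Matrix.one_mul, hE₁]
    have t₂ : Matrix.trace F₂ = 1 := by
      rw [hF₂, Matrix.trace_mul_cycle, hb₂, Matrix.one_mul, hE₂]
    have t₃ : Matrix.trace (pauliString sW * F₁ * pauliString sW) = 1 := by
      rw [Matrix.trace_mul_cycle, pauliString_sq15, Matrix.one_mul, t₁]
    have key := trace_complete15' (pauliString sW * F₁ * pauliString sW) F₂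
    rw [t₂, t₃, mul_one, mul_one] at key
    rw [← key]
    simp only [dotProduct, Fintype.sum_prod_type, mul_ite, mul_one, mul_zero,
      Finset.sum_ite_eq, Finset.mem_univ, if_true, Finset.mul_sum]
    refine Finset.sum_congr rfl fun σ _ => ?_
    have h1 : Matrix.trace (pauliString sW * F₁ * pauliString sW * normPauli σ.1)
        = Matrix.trace (F₁ * (pauliString sW * normPauli σ.1 * pauliString sW)) := by
      rw [Matrix.mul_assoc, Matrix.mul_assoc, Matrix.trace_mul_comm]
      simp only [Matrix.mul_assoc]
    rw [← normPauli_conj15, Matrix.mul_smul, Matrix.trace_smul, smul_eq_mul] at h1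
    rw [h1]
    ring
  · simp only [dotProduct, Fintype.sum_prod_type, Finset.sum_mul]
    simp only [Finset.mul_sum]
    refine Finset.sum_congr rfl fun i _ => Finset.sum_congr rfl fun j _ => by ring

end
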